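/- arXiv:2304.08755 — 4 statements merged into one kernel-verified Lean document; each statement's English description precedes it below -/
import Mathlib

section
/- Let m ≥ 1, let α₁,…,α_m > 0 and α = α₁+⋯+α_m, and let k : (ℝ^{2n+1})^m → [0,∞) be a measurable kernel. Define the m-linear operator T_m(f₁,…,f_m)(x) = ∫_{(ℝ^{2n+1})^m} k(y₁,…,y_m) f₁(δ_{|x|_h}y₁)⋯f_m(δ_{|x|_h}y_m) dy₁⋯dy_m for x ≠ 0. If H_m := ∫_{(ℝ^{2n+1})^m} k(y₁,…,y_m) ∏_{i=1}^m |y_i|_h^{-α_i} dy₁⋯dy_m < ∞, then for all f_i ∈ H^∞_{α_i}(ℍⁿ) (i = 1,…,m) one has ‖T_m(f₁,…,f_m)‖_{H^∞_α} ≤ H_m ∏_{i=1}^m ‖f_i‖_{H^∞_{α_i}}; in particular T_m is bounded from H^∞_{α₁}(ℍⁿ)×⋯×H^∞_{α_m}(ℍⁿ) to H^∞_α(ℍⁿ). -/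
open MeasureTheory ENNReal

/-- The Korányi (homogeneous) norm on the Heisenberg group `ℍⁿ ≃ ℝ^{2n+1}`. -/
noncomputable def hnorm (n : ℕ) (x : Fin (2*n+1) → ℝ) : ℝ :=
  ((∑ i : Fin (2*n+1), if (i : ℕ) < 2*n then (x i)^2 else 0)^2
    + (x (Fin.last (2*n)))^2) ^ ((1:ℝ)/4)

/-- The Heisenberg dilations `δ_r`. -/
noncomputable def dil (n : ℕ) (r : ℝ) (x : Fin (2*n+1) → ℝ) : Fin (2*n+1) → ℝ :=
  fun i => if (i : ℕ) < 2*n then r * x i else r^2 * x i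

/-- The norm of the weighted-type space `H^∞_α(ℍⁿ)`:
`‖f‖ = ess sup_x |x|_h^α |f x|`. -/
noncomputable def wnorm (n : ℕ) (α : ℝ) (f : (Fin (2*n+1) → ℝ) → ℝ) : ℝ≥0∞ :=
  essSup (fun x => ENNReal.ofReal (hnorm n x ^ α * |f x|)) volume

/-- `Ω_Q`: the volume of the Korányi unit ball. -/
noncomputable def ΩQ (n : ℕ) : ℝ :=
  (volume {x : Fin (2*n+1) → ℝ | hnorm n x < 1}).toReal

theorem hnorm_nonneg' (n : ℕ) (x : Fin (2*n+1) → ℝ) : 0 ≤ hnorm n x := by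
  unfold hnorm; positivity

theorem hnorm_pos' (n : ℕ) (x : Fin (2*n+1) → ℝ) (h : x (Fin.last (2*n)) ≠ 0) :
    0 < hnorm n x := by
  unfold hnorm; positivity

theorem hnorm_dil' (n : ℕ) (r : ℝ) (hr : 0 ≤ r) (x : Fin (2*n+1) → ℝ) :
    hnorm n (dil n r x) = r * hnorm n x := by
  unfold hnorm
  have h1 : (∑ i : Fin (2*n+1), if (i : ℕ) < 2*n then (dil n r x i)^2 else 0)
      = r^2 * ∑ i : Fin (2*n+1), if (i : ℕ) < 2*n then (x i)^2 else 0 := by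
    rw [Finset.mul_sum]
    refine Finset.sum_congr rfl fun i _ => ?_
    by_cases hi : (i : ℕ) < 2*n
    · simp [dil, hi]; ring
    · simp [hi]
  have h2 : dil n r x (Fin.last (2*n)) = r^2 * x (Fin.last (2*n)) := by simp [dil]
  rw [h1, h2]
  set S := ∑ i : Fin (2*n+1), if (i : ℕ) < 2*n then (x i)^2 else 0
  have h3 : (r^2 * S)^2 + (r^2 * x (Fin.last (2*n)))^2
      = r^4 * (S^2 + (x (Fin.last (2*n)))^2) := by ring
  rw [h3, Real.mul_rpow (by positivity) (by positivity)]
  congr 1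
  rw [← Real.rpow_natCast, ← Real.rpow_mul hr]
  norm_num

theorem dil_qmp (n : ℕ) (r : ℝ) (hr : 0 < r) :
    Measure.QuasiMeasurePreserving (dil n r) volume volume := by
  let D : Fin (2*n+1) → ℝ := fun i => if (i : ℕ) < 2*n then r else r^2
  have hD : (Matrix.diagonal D).det ≠ 0 := by
    rw [Matrix.det_diagonal, Finset.prod_ne_zero_iff]
    intro i _
    simp only [D]
    split_ifs <;> positivity
  have he : dil n r = Matrix.toLin' (Matrix.diagonal D) := by
    ext x i
    simp only [dil, Matrix.toLin'_apply, Matrix.mulVec_diagonal, D]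
    split_ifs <;> rfl
  rw [he]
  refine ⟨(LinearMap.continuous_of_finiteDimensional _).measurable, ?_⟩
  intro s hs
  have h := Real.smul_map_diagonal_volume_pi hD
  rw [← h] at hs
  simp only [Measure.smul_apply, smul_eq_mul, mul_eq_zero, ENNReal.ofReal_eq_zero] at hs
  rcases hs with hs | hs
  · exact absurd (abs_nonpos_iff.mp hs) hD
  · exact hs

/-- boundedness of the `m`-linear integral operator with nonnegative
kernel `k` from `H^∞_{α₁} × ⋯ × H^∞_{α_m}` to `H^∞_α`, with constant `H_m`. -/
theorem statement0 (n : ℕ) (hn : 1 ≤ n) (m : ℕ) (hm : 1 ≤ m)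
    (α : Fin m → ℝ) (hα : ∀ i, 0 < α i)
    (k : (Fin m → Fin (2*n+1) → ℝ) → ℝ)
    (hkmeas : Measurable k) (hknonneg : ∀ y, 0 ≤ k y)
    (Hm : ℝ≥0∞)
    (hHm : Hm = ∫⁻ y : Fin m → Fin (2*n+1) → ℝ,
      ENNReal.ofReal (k y * ∏ i, hnorm n (y i) ^ (-(α i))))
    (hHmfin : Hm < ⊤)
    (f : Fin m → (Fin (2*n+1) → ℝ) → ℝ)
    (hfmeas : ∀ i, Measurable (f i))
    (hffin : ∀ i, wnorm n (α i) (f i) < ⊤) :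
    wnorm n (∑ i, α i)
        (fun x => ∫ y : Fin m → Fin (2*n+1) → ℝ,
          k y * ∏ i, f i (dil n (hnorm n x) (y i)))
      ≤ Hm * ∏ i, wnorm n (α i) (f i) := by
  have hA : 0 < ∑ i, α i := Finset.sum_pos (fun i _ => hα i) ⟨⟨0, hm⟩, Finset.mem_univ _⟩
  unfold wnorm
  refine essSup_le_of_ae_le _ (Filter.Eventually.of_forall fun x => ?_)
  show ENNReal.ofReal (hnorm n x ^ (∑ i, α i) * |∫ y : Fin m → Fin (2*n+1) → ℝ,
          k y * ∏ i, f i (dil n (hnorm n x) (y i))|) ≤ Hm * ∏ i, wnorm n (α i) (f i)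
  rcases (hnorm_nonneg' n x).eq_or_lt with h0 | hr
  · rw [← h0, Real.zero_rpow hA.ne']
    simp
  generalize hnorm n x = r at hr
  have hW : ∏ i, wnorm n (α i) (f i) ≠ ⊤ :=
    ENNReal.prod_ne_top fun i _ => (hffin i).ne
  have hae1 : ∀ᵐ y : Fin m → Fin (2*n+1) → ℝ, ∀ i, 0 < hnorm n (y i) := by
    rw [ae_all_iff]
    intro i
    have h1 : ∀ᵐ t : ℝ, t ≠ 0 := by simp [ae_iff]
    have h2 : ∀ᵐ z : Fin (2*n+1) → ℝ, z (Fin.last (2*n)) ≠ 0 :=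
      (Measure.quasiMeasurePreserving_eval (fun _ : Fin (2*n+1) => (volume : Measure ℝ)) (Fin.last (2*n))).ae h1
    have h3 : ∀ᵐ z : Fin (2*n+1) → ℝ, 0 < hnorm n z := h2.mono fun z hz => hnorm_pos' n z hz
    exact (Measure.quasiMeasurePreserving_eval
      (fun _ : Fin m => (volume : Measure (Fin (2*n+1) → ℝ))) i).ae h3
  have hae2 : ∀ᵐ y : Fin m → Fin (2*n+1) → ℝ, ∀ i,
      ENNReal.ofReal (hnorm n (dil n r (y i)) ^ (α i) * |f i (dil n r (y i))|)
        ≤ wnorm n (α i) (f i) := by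
    rw [ae_all_iff]
    intro i
    have h1 : ∀ᵐ z : Fin (2*n+1) → ℝ,
        ENNReal.ofReal (hnorm n z ^ (α i) * |f i z|) ≤ wnorm n (α i) (f i) :=
      ENNReal.ae_le_essSup _
    have h2 := (dil_qmp n r hr).ae h1
    exact (Measure.quasiMeasurePreserving_eval
      (fun _ : Fin m => (volume : Measure (Fin (2*n+1) → ℝ))) i).ae h2
  rw [ENNReal.ofReal_mul (by positivity), ← Real.norm_eq_abs, ofReal_norm]
  refine (mul_le_mul_right (enorm_integral_le_lintegral_enorm _) _).trans ?_
  rw [← lintegral_const_mul' _ _ ENNReal.ofReal_ne_top, hHm, ← lintegral_mul_const' _ _ hW]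
  refine lintegral_mono_ae ?_
  filter_upwards [hae1, hae2] with y hy1 hy2
  refine le_trans (le_of_eq ?_) (mul_le_mul_right (Finset.prod_le_prod' fun i _ => hy2 i) _)
  rw [← ofReal_norm, ← ENNReal.ofReal_mul (by positivity),
    ← ENNReal.ofReal_prod_of_nonneg
      (fun i _ => mul_nonneg (Real.rpow_nonneg (hnorm_nonneg' _ _) _) (abs_nonneg _)),
    ← ENNReal.ofReal_mul (mul_nonneg (hknonneg y)
      (Finset.prod_nonneg fun i _ => Real.rpow_nonneg (hnorm_nonneg' _ _) _))]
  congr 1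
  rw [Real.norm_eq_abs, abs_mul, abs_of_nonneg (hknonneg y), Finset.abs_prod,
    Real.rpow_sum_of_pos hr, mul_left_comm, mul_assoc, ← Finset.prod_mul_distrib,
    ← Finset.prod_mul_distrib]
  congr 1
  refine Finset.prod_congr rfl fun i _ => ?_
  rw [hnorm_dil' n r hr.le, Real.mul_rpow hr.le (hy1 i).le, Real.rpow_neg (hy1 i).le]
  have := (Real.rpow_pos_of_pos (hy1 i) (α i)).ne'
  field_simp
end

section
/- Let m ≥ 1, let α₁,…,α_m be real numbers with 0 < α_i < Q for each i, and let α = α₁+⋯+α_m. Then Ω_Q^{-m} ∫_{{(y₁,…,y_m) : (|y₁|_h²+⋯+|y_m|_h²)^{1/2} < 1}} ∏_{i=1}^m |y_i|_h^{-α_i} dy₁⋯dy_m = (2Q^m / (2^m(mQ-α))) · (∏_{i=1}^m Γ((Q-α_i)/2)) / Γ((mQ-α)/2). -/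
open MeasureTheory ENNReal

namespace St6
open Set

lemma lint_rpow (A s : ℝ) (hA : 0 < A) (hs : 0 < s) :
    ∫⁻ t in Ioo 0 s, ENNReal.ofReal (A * t ^ (A - 1)) = ENNReal.ofReal (s ^ A) := by
  have hInt : IntegrableOn (fun t : ℝ => A * t ^ (A - 1)) (Ioc 0 s) := by
    have := (intervalIntegral.intervalIntegrable_rpow' (a := 0) (b := s) (r := A - 1)
      (by linarith)).const_mul A
    rwa [intervalIntegrable_iff_integrableOn_Ioc_of_le hs.le] at this
  rw [restrict_Ioo_eq_restrict_Ioc, ← ofReal_integral_eq_lintegral_ofReal hInt]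
  · rw [← intervalIntegral.integral_of_le hs.le, intervalIntegral.integral_const_mul,
      integral_rpow (Or.inl (by linarith))]
    congr 1
    rw [sub_add_cancel, Real.zero_rpow hA.ne']
    field_simp
    ring
  · filter_upwards [ae_restrict_mem measurableSet_Ioc] with t ht
    have := ht.1
    positivity

/-- measure with power distribution function -/
lemma map_eq {X : Type*} [MeasurableSpace X] (ν : Measure X) (g : X → ℝ) (hg : Measurable g)
    (hg0 : ∀ x, 0 ≤ g x) (c : ℝ≥0∞) (hc : c ≠ ∞) (A : ℝ) (hA : 0 < A)
    (h : ∀ s : ℝ, 0 < s → ν {x | g x < s} = c * ENNReal.ofReal (s ^ A)) :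
    ν.map g = c • (volume.restrict (Ioi 0)).withDensity
      (fun t => ENNReal.ofReal (A * t ^ (A - 1))) := by
  have h1 : ∀ s : ℝ, (ν.map g) (Iio s) = if 0 < s then c * ENNReal.ofReal (s ^ A) else 0 := by
    intro s
    rw [Measure.map_apply hg measurableSet_Iio]
    split_ifs with hs
    · exact h s hs
    · have : g ⁻¹' Iio s = ∅ := by
        ext x
        simp only [mem_preimage, mem_Iio, mem_empty_iff_false, iff_false]
        linarith [hg0 x]
      rw [this, measure_empty]
  have h2 : ∀ s : ℝ, (c • (volume.restrict (Ioi 0)).withDensity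
      (fun t => ENNReal.ofReal (A * t ^ (A - 1)))) (Iio s)
      = if 0 < s then c * ENNReal.ofReal (s ^ A) else 0 := by
    intro s
    rw [Measure.smul_apply, withDensity_apply _ measurableSet_Iio,
      Measure.restrict_restrict measurableSet_Iio, smul_eq_mul]
    split_ifs with hs
    · rw [Iio_inter_Ioi, lint_rpow A s hA hs]
    · rw [Iio_inter_Ioi, Ioo_eq_empty hs]; simp
  have hfin : ∀ s : ℝ, (ν.map g) (Iio s) ≠ ∞ := by
    intro s
    rw [h1]
    split_ifs
    · exact ENNReal.mul_ne_top hc ENNReal.ofReal_ne_top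
    · simp
  have hfin2 : ∀ s : ℝ, (c • (volume.restrict (Ioi 0)).withDensity
      (fun t => ENNReal.ofReal (A * t ^ (A - 1)))) (Iio s) ≠ ∞ := by
    intro s
    rw [h2, ← h1]; exact hfin s
  apply Measure.ext_of_Ico'
  · intro a b _
    exact ne_top_of_le_ne_top (hfin b) (measure_mono Ico_subset_Iio_self)
  · intro a b hab
    have : Ico a b = Iio b \ Iio a := by
      ext x; simp [and_comm]
    rw [this, measure_sdiff (Iio_subset_Iio hab.le) measurableSet_Iio.nullMeasurableSet (hfin a),
      measure_sdiff (Iio_subset_Iio hab.le) measurableSet_Iio.nullMeasurableSet (hfin2 a),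
      h1, h1, h2, h2]

lemma lint_gamma {X : Type*} [MeasurableSpace X] (ν : Measure X) (g : X → ℝ) (hg : Measurable g)
    (hg0 : ∀ x, 0 ≤ g x) (c : ℝ≥0∞) (hc : c ≠ ∞) (A : ℝ) (hA : 0 < A)
    (h : ∀ s : ℝ, 0 < s → ν {x | g x < s} = c * ENNReal.ofReal (s ^ A)) (b : ℝ) (hb : b < A) :
    ∫⁻ x, ENNReal.ofReal (Real.exp (-g x) * g x ^ (-b)) ∂ν
      = c * ENNReal.ofReal (A * Real.Gamma (A - b)) := by
  have hm : Measurable (fun t : ℝ => ENNReal.ofReal (Real.exp (-t) * t ^ (-b))) := by fun_prop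
  rw [← lintegral_map (f := fun t : ℝ => ENNReal.ofReal (Real.exp (-t) * t ^ (-b))) hm hg,
    map_eq ν g hg hg0 c hc A hA h, lintegral_smul_measure, smul_eq_mul,
    lintegral_withDensity_eq_lintegral_mul _ (by fun_prop) hm]
  congr 1
  have hab : 0 < A - b := by linarith
  rw [Real.Gamma_eq_integral hab, ← integral_const_mul,
    ofReal_integral_eq_lintegral_ofReal ((Real.GammaIntegral_convergent hab).const_mul A)]
  · apply setLIntegral_congr_fun measurableSet_Ioi
    intro t ht
    have ht : 0 < t := ht
    simp only [Pi.mul_apply]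
    rw [← ENNReal.ofReal_mul (by positivity)]
    congr 1
    rw [show A - b - 1 = (A - 1) + (-b) by ring, Real.rpow_add ht]
    ring
  · filter_upwards [ae_restrict_mem measurableSet_Ioi] with t ht
    have ht : 0 < t := ht
    simp only [Pi.zero_apply]
    positivity

lemma hnorm_nonneg (n : ℕ) (x) : 0 ≤ hnorm n x := by unfold hnorm; positivity

lemma hnorm_cont (n : ℕ) : Continuous (hnorm n) := by
  unfold hnorm
  apply Continuous.rpow_const
  · refine Continuous.add (Continuous.pow (continuous_finsetSum _ fun i _ => ?_) 2) (by fun_prop)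
    split_ifs <;> fun_prop
  · intro x; right; norm_num

@[fun_prop]
lemma hnorm_meas (n : ℕ) : Measurable (hnorm n) := (hnorm_cont n).measurable

lemma hnorm_dil (n : ℕ) (r : ℝ) (hr : 0 < r) (x) : hnorm n (dil n r x) = r * hnorm n x := by
  unfold hnorm dil
  have h1 : (∑ i : Fin (2*n+1), if (i : ℕ) < 2*n then
      ((if (i : ℕ) < 2*n then r * x i else r^2 * x i))^2 else 0)
      = r^2 * ∑ i : Fin (2*n+1), if (i : ℕ) < 2*n then (x i)^2 else 0 := by
    rw [Finset.mul_sum]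
    refine Finset.sum_congr rfl fun i _ => ?_
    split_ifs <;> ring
  rw [h1]
  simp only [Fin.val_last, lt_irrefl, if_false]
  rw [show ∀ S t : ℝ, (r^2*S)^2 + (r^2*t)^2 = r^4 * (S^2+t^2) by intros; ring,
    Real.mul_rpow (by positivity) (by positivity)]
  congr 1
  rw [← Real.rpow_natCast, ← Real.rpow_mul hr.le]
  norm_num

lemma dil_meas (n : ℕ) (r : ℝ) : Measurable (dil n r) := by
  unfold dil
  refine measurable_pi_lambda _ fun i => ?_
  split_ifs <;> fun_prop

lemma vol_dil (n : ℕ) (r : ℝ) (hr : 0 < r) :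
    ENNReal.ofReal (r ^ (2*n+2)) • (volume : Measure (Fin (2*n+1) → ℝ)).map (dil n r)
      = volume := by
  have hd : (Matrix.diagonal (fun i : Fin (2*n+1) => if (i : ℕ) < 2*n then r else r^2)).det
      = r ^ (2*n+2) := by
    rw [Matrix.det_diagonal, Fin.prod_univ_castSucc]
    simp
    ring
  have := Real.smul_map_diagonal_volume_pi
    (D := fun i : Fin (2*n+1) => if (i : ℕ) < 2*n then r else r^2) (by rw [hd]; positivity)
  rw [hd, abs_of_pos (by positivity)] at this
  convert this using 3
  ext x i
  simp [dil, Matrix.mulVec_diagonal]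

lemma vol_dil_pi (n m : ℕ) (r : ℝ) (hr : 0 < r) :
    ENNReal.ofReal (r ^ (2*n+2)) ^ m • (volume : Measure (Fin m → Fin (2*n+1) → ℝ)).map
      (fun y i => dil n r (y i)) = volume := by
  have hm : Measurable (fun (y : Fin m → Fin (2*n+1) → ℝ) i => dil n r (y i)) :=
    measurable_pi_lambda _ fun i => (dil_meas n r).comp (measurable_pi_apply i)
  symm
  refine Measure.pi_eq fun s hs => ?_
  rw [Measure.smul_apply, Measure.map_apply hm (MeasurableSet.univ_pi hs)]
  have : (fun (y : Fin m → Fin (2*n+1) → ℝ) i => dil n r (y i)) ⁻¹' (univ.pi s)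
      = univ.pi (fun i => dil n r ⁻¹' s i) := by
    ext y; simp
  rw [this, volume_pi_pi]
  have : ∀ i, volume (s i) = ENNReal.ofReal (r ^ (2*n+2)) * volume (dil n r ⁻¹' s i) := by
    intro i
    conv_lhs => rw [← vol_dil n r hr]
    rw [Measure.smul_apply, Measure.map_apply (dil_meas n r) (hs i), smul_eq_mul]
  simp_rw [this]
  rw [Finset.prod_mul_distrib]
  simp

lemma ball_scale (n : ℕ) (s : ℝ) (hs : 0 < s) :
    volume {x | hnorm n x ^ 2 < s}
      = volume {x | hnorm n x < 1} * ENNReal.ofReal (s ^ ((n:ℝ)+1)) := by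
  have hr : 0 < √s := Real.sqrt_pos.2 hs
  have hms : MeasurableSet {x | hnorm n x ^ 2 < s} :=
    measurableSet_lt (by fun_prop) measurable_const
  conv_lhs => rw [← vol_dil n _ hr]
  rw [Measure.smul_apply, Measure.map_apply (dil_meas n _) hms, smul_eq_mul, mul_comm]
  congr 2
  · ext x
    simp only [mem_preimage, mem_ofPred_eq, hnorm_dil n _ hr, mul_pow, Real.sq_sqrt hs.le]
    rw [mul_lt_iff_lt_one_right hs, sq_lt_one_iff₀ (hnorm_nonneg n x)]
  · rw [show 2*n+2 = 2*(n+1) by ring, pow_mul, Real.sq_sqrt hs.le, ← Real.rpow_natCast]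
    push_cast; rfl

lemma ball_ne_top (n : ℕ) : volume {x | hnorm n x < 1} ≠ ∞ := by
  have : {x | hnorm n x < 1} ⊆ Icc (fun _ : Fin (2*n+1) => (-1:ℝ)) (fun _ => 1) := by
    intro x hx
    have hx : hnorm n x < 1 := hx
    have key : (∑ i : Fin (2*n+1), if (i : ℕ) < 2*n then (x i)^2 else 0)^2
        + (x (Fin.last (2*n)))^2 < 1 := by
      by_contra hcon
      push Not at hcon
      exact absurd hx (not_lt.2 (Real.one_le_rpow hcon (by norm_num)))
    have hS : 0 ≤ ∑ i : Fin (2*n+1), if (i : ℕ) < 2*n then (x i)^2 else 0 :=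
      Finset.sum_nonneg fun i _ => by split_ifs <;> positivity
    have hx1 : ∀ i, x i ^ 2 ≤ 1 := by
      intro i
      by_cases hi : (i : ℕ) < 2*n
      · have := Finset.single_le_sum (f := fun i : Fin (2*n+1) =>
          if (i : ℕ) < 2*n then (x i)^2 else 0)
          (fun i _ => by split_ifs <;> positivity) (Finset.mem_univ i)
        simp only [hi, if_true] at this
        nlinarith [sq_nonneg (x (Fin.last (2*n)))]
      · have : i = Fin.last (2*n) := by
          apply Fin.ext
          have := i.2
          simp only [Fin.val_last]
          omega
        rw [this]
        nlinarith
    rw [mem_Icc, Pi.le_def, Pi.le_def]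
    exact ⟨fun i => by nlinarith [hx1 i], fun i => by nlinarith [hx1 i]⟩
  refine ne_top_of_le_ne_top ?_ (measure_mono this)
  exact isCompact_Icc.measure_lt_top.ne

lemma ball_pos (n : ℕ) : volume {x | hnorm n x < 1} ≠ 0 := by
  refine (IsOpen.measure_pos _ (isOpen_lt (hnorm_cont n) continuous_const) ⟨0, ?_⟩).ne'
  simp [hnorm]

lemma ball_eq (n : ℕ) : volume {x | hnorm n x < 1} = ENNReal.ofReal (ΩQ n) := by
  rw [ΩQ, ENNReal.ofReal_toReal (ball_ne_top n)]

lemma Om_pos (n : ℕ) : 0 < ΩQ n := ENNReal.toReal_pos (ball_pos n) (ball_ne_top n)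

lemma sq_rpow (n : ℕ) (x) (a : ℝ) : (hnorm n x ^ 2) ^ (-(a/2)) = hnorm n x ^ (-a) := by
  rw [← Real.rpow_natCast, ← Real.rpow_mul (hnorm_nonneg n x)]
  congr 1
  push_cast; ring

lemma single (n : ℕ) (a : ℝ) (ha : a < 2*n+2) :
    ∫⁻ x, ENNReal.ofReal (Real.exp (-hnorm n x ^ 2) * hnorm n x ^ (-a))
      = ENNReal.ofReal (ΩQ n * ((n + 1) * Real.Gamma ((2*n+2-a)/2))) := by
  have := lint_gamma volume (fun x => hnorm n x ^ 2) (by fun_prop) (fun x => by positivity)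
    _ (ball_ne_top n) ((n:ℝ)+1) (by positivity) (ball_scale n) (a/2) (by linarith)
  simp_rw [sq_rpow] at this
  rw [this, ball_eq, ← ENNReal.ofReal_mul (Om_pos n).le]
  congr 4
  ring

/-- weight -/
noncomputable def W (n m : ℕ) (α : Fin m → ℝ) (y : Fin m → Fin (2*n+1) → ℝ) : ℝ :=
  ∏ i, hnorm n (y i) ^ (-(α i))

/-- sum of squares -/
noncomputable def G (n m : ℕ) (y : Fin m → Fin (2*n+1) → ℝ) : ℝ := ∑ i, hnorm n (y i) ^ 2

lemma W_nonneg (n m : ℕ) (α : Fin m → ℝ) (y) : 0 ≤ W n m α y :=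
  Finset.prod_nonneg fun i _ => Real.rpow_nonneg (hnorm_nonneg n _) _

lemma G_nonneg (n m : ℕ) (y) : 0 ≤ G n m y := Finset.sum_nonneg fun i _ => by positivity

@[fun_prop]
lemma W_meas (n m : ℕ) (α : Fin m → ℝ) : Measurable (W n m α) := by
  unfold W
  exact Finset.measurable_fun_prod _ fun i _ => by fun_prop

@[fun_prop]
lemma G_meas (n m : ℕ) : Measurable (G n m) := by
  unfold G
  exact Finset.measurable_fun_sum _ fun i _ => by fun_prop

lemma total (n m : ℕ) (α : Fin m → ℝ) (hα : ∀ i, α i < 2*n+2) :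
    ∫⁻ y, ENNReal.ofReal (Real.exp (-G n m y) * W n m α y)
      = ENNReal.ofReal (∏ i, (ΩQ n * ((n + 1) * Real.Gamma ((2*n+2-α i)/2)))) := by
  have h0 : ∀ i x, 0 ≤ Real.exp (-hnorm n x ^ 2) * hnorm n x ^ (-α i) := fun i x =>
    mul_nonneg (Real.exp_pos _).le (Real.rpow_nonneg (hnorm_nonneg n _) _)
  have hInt : ∀ i, Integrable (fun x => Real.exp (-hnorm n x ^ 2) * hnorm n x ^ (-α i)) := by
    intro i
    refine ⟨by fun_prop, ?_⟩
    rw [hasFiniteIntegral_iff_ofReal (Filter.Eventually.of_forall (h0 i)), single n _ (hα i)]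
    exact ENNReal.ofReal_lt_top
  have hval : ∀ i, ∫ x, Real.exp (-hnorm n x ^ 2) * hnorm n x ^ (-α i)
      = ΩQ n * ((n + 1) * Real.Gamma ((2*n+2-α i)/2)) := by
    intro i
    rw [integral_eq_lintegral_of_nonneg_ae (Filter.Eventually.of_forall (h0 i)) (by fun_prop),
      single n _ (hα i), ENNReal.toReal_ofReal]
    have := Real.Gamma_pos_of_pos (s := (2*n+2-α i)/2) (by linarith [hα i])
    have := Om_pos n
    positivity
  have e : ∀ y, Real.exp (-G n m y) * W n m α y
      = ∏ i, (Real.exp (-hnorm n (y i) ^ 2) * hnorm n (y i) ^ (-α i)) := by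
    intro y
    rw [Finset.prod_mul_distrib, ← Real.exp_sum, G, W, Finset.sum_neg_distrib]
  simp_rw [e]
  rw [volume_pi, ← ofReal_integral_eq_lintegral_ofReal (Integrable.fintype_prod hInt)
    (Filter.Eventually.of_forall fun y => Finset.prod_nonneg fun i _ => h0 i _)]
  rw [integral_fintype_prod_eq_prod (fun i x => Real.exp (-hnorm n x ^ 2) * hnorm n x ^ (-α i))]
  simp_rw [hval]

/-- weighted measure -/
noncomputable def nu (n m : ℕ) (α : Fin m → ℝ) : Measure (Fin m → Fin (2*n+1) → ℝ) :=
  volume.withDensity (fun y => ENNReal.ofReal (W n m α y))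

lemma nu_scale (n m : ℕ) (α : Fin m → ℝ) (hα : ∀ i, α i < 2*n+2) (s : ℝ) (hs : 0 < s) :
    nu n m α {y | G n m y < s} = nu n m α {y | G n m y < 1} *
      ENNReal.ofReal (s ^ ((m * (2*n+2) - ∑ i, α i)/2)) := by
  have hr : 0 < √s := Real.sqrt_pos.2 hs
  have hms : ∀ s, MeasurableSet {y | G n m y < s} := fun s =>
    measurableSet_lt (by fun_prop) measurable_const
  have hm : Measurable (fun (y : Fin m → Fin (2*n+1) → ℝ) i => dil n (√s) (y i)) :=
    measurable_pi_lambda _ fun i => (dil_meas n _).comp (measurable_pi_apply i)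
  have hG : ∀ y : Fin m → Fin (2*n+1) → ℝ, G n m (fun i => dil n (√s) (y i)) = s * G n m y := by
    intro y
    simp only [G, hnorm_dil n _ hr, mul_pow, Real.sq_sqrt hs.le, Finset.mul_sum]
  have hW : ∀ y : Fin m → Fin (2*n+1) → ℝ, W n m α (fun i => dil n (√s) (y i))
      = (√s) ^ (-∑ i, α i) * W n m α y := by
    intro y
    simp only [W, hnorm_dil n _ hr]
    rw [← Finset.sum_neg_distrib, Real.rpow_sum_of_pos hr, ← Finset.prod_mul_distrib]
    exact Finset.prod_congr rfl fun i _ => Real.mul_rpow hr.le (hnorm_nonneg n _)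
  rw [nu, withDensity_apply _ (hms _), withDensity_apply _ (hms _)]
  conv_lhs => rw [← vol_dil_pi n m _ hr]
  rw [Measure.restrict_smul, lintegral_smul_measure, setLIntegral_map (hms _) (by fun_prop) hm,
    smul_eq_mul]
  simp_rw [hW]
  have : (fun (y : Fin m → Fin (2*n+1) → ℝ) i => dil n (√s) (y i)) ⁻¹' {y | G n m y < s}
      = {y | G n m y < 1} := by
    ext y
    simp only [mem_preimage, mem_ofPred_eq, hG]
    rw [mul_lt_iff_lt_one_right hs]
  rw [this]
  have hp : 0 ≤ (√s) ^ (-∑ i, α i) := by positivity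
  simp_rw [ENNReal.ofReal_mul hp]
  rw [lintegral_const_mul _ (by fun_prop), ← mul_assoc, mul_comm]
  congr 1
  rw [← ENNReal.ofReal_pow (by positivity), ← ENNReal.ofReal_mul (by positivity)]
  congr 1
  rw [← pow_mul, ← Real.rpow_natCast, ← Real.rpow_add hr, Real.sqrt_eq_rpow, ← Real.rpow_mul hs.le]
  congr 1
  push_cast
  ring

lemma nu_ne_top (n m : ℕ) (α : Fin m → ℝ) (hα : ∀ i, α i < 2*n+2) :
    nu n m α {y | G n m y < 1} ≠ ∞ := by
  have hms : MeasurableSet {y | G n m y < 1} :=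
    measurableSet_lt (by fun_prop) measurable_const
  rw [nu, withDensity_apply _ hms]
  have : ∫⁻ y in {y | G n m y < 1}, ENNReal.ofReal (W n m α y)
      ≤ ∫⁻ y, ENNReal.ofReal (Real.exp 1) *
        ENNReal.ofReal (Real.exp (-G n m y) * W n m α y) := by
    refine le_trans (setLIntegral_mono' hms fun y hy => ?_) (setLIntegral_le_lintegral _ _)
    have hy : G n m y < 1 := hy
    rw [← ENNReal.ofReal_mul (Real.exp_pos _).le, ← mul_assoc, ← Real.exp_add]
    apply ENNReal.ofReal_le_ofReal
    exact le_mul_of_one_le_left (W_nonneg ..) (Real.one_le_exp (by linarith))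
  refine ne_top_of_le_ne_top ?_ this
  rw [lintegral_const_mul _ (by fun_prop), total n m α hα]
  exact ENNReal.mul_ne_top ENNReal.ofReal_ne_top ENNReal.ofReal_ne_top

end St6

/-- the explicit value of the sharp Hardy constant
`𝒜_m^h = (2Q^m / (2^m (mQ - α))) ∏ Γ((Q-αᵢ)/2) / Γ((mQ-α)/2)`. -/
theorem statement6 (n : ℕ) (hn : 1 ≤ n) (m : ℕ) (hm : 1 ≤ m)
    (Q : ℝ) (hQ : Q = 2*n+2)
    (α : Fin m → ℝ) (hα : ∀ i, 0 < α i ∧ α i < Q) :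
    (ΩQ n ^ m)⁻¹ *
        ∫ y in {y : Fin m → Fin (2*n+1) → ℝ | Real.sqrt (∑ i, hnorm n (y i) ^ 2) < 1},
          ∏ i, hnorm n (y i) ^ (-(α i))
      = (2 * Q ^ m / (2 ^ m * (m * Q - ∑ i, α i))) *
          (∏ i, Real.Gamma ((Q - α i) / 2)) / Real.Gamma ((m * Q - ∑ i, α i) / 2) := by
  subst hQ
  have hα' : ∀ i, α i < 2*n+2 := fun i => (hα i).2
  set A : ℝ := (m * (2*n+2) - ∑ i, α i)/2 with hAdef
  have hA : 0 < A := by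
    have : ∑ i, α i < ∑ _i : Fin m, ((2:ℝ)*n+2) :=
      Finset.sum_lt_sum_of_nonempty ⟨⟨0, hm⟩, Finset.mem_univ _⟩ fun i _ => hα' i
    simp only [Finset.sum_const, Finset.card_univ, Fintype.card_fin, nsmul_eq_mul] at this
    rw [hAdef]; linarith
  have hms : MeasurableSet {y | St6.G n m y < 1} :=
    measurableSet_lt (by fun_prop) measurable_const
  have hset : {y : Fin m → Fin (2*n+1) → ℝ | Real.sqrt (∑ i, hnorm n (y i) ^ 2) < 1}
      = {y | St6.G n m y < 1} := by
    ext y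
    simp only [Set.mem_ofPred_eq, St6.G]
    rw [Real.sqrt_lt' one_pos, one_pow]
  have hI : ∫ y in {y : Fin m → Fin (2*n+1) → ℝ | Real.sqrt (∑ i, hnorm n (y i) ^ 2) < 1},
      ∏ i, hnorm n (y i) ^ (-(α i)) = (St6.nu n m α {y | St6.G n m y < 1}).toReal := by
    rw [hset, St6.nu, withDensity_apply _ hms]
    exact integral_eq_lintegral_of_nonneg_ae
      (Filter.Eventually.of_forall fun y => St6.W_nonneg n m α y)
      (St6.W_meas n m α).aestronglyMeasurable
  have hg := St6.lint_gamma (St6.nu n m α) (St6.G n m) (by fun_prop) (St6.G_nonneg n m) _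
    (St6.nu_ne_top n m α hα') A hA (St6.nu_scale n m α hα') 0 hA
  have ht : ∫⁻ y, ENNReal.ofReal (Real.exp (-St6.G n m y) * St6.G n m y ^ (-(0:ℝ)))
      ∂(St6.nu n m α) = ∫⁻ y, ENNReal.ofReal (Real.exp (-St6.G n m y) * St6.W n m α y) := by
    rw [St6.nu, lintegral_withDensity_eq_lintegral_mul _ (by fun_prop) (by fun_prop)]
    refine lintegral_congr fun y => ?_
    simp only [Pi.mul_apply, neg_zero, Real.rpow_zero, mul_one]
    rw [← ENNReal.ofReal_mul (St6.W_nonneg ..), mul_comm]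
  rw [ht, St6.total n m α hα', sub_zero] at hg
  have hΓ : ∀ i, 0 < Real.Gamma ((2*n+2-α i)/2) := fun i =>
    Real.Gamma_pos_of_pos (by linarith [hα' i])
  have hΓA := Real.Gamma_pos_of_pos hA
  have hΩ := St6.Om_pos n
  have hg2 := congrArg ENNReal.toReal hg
  rw [ENNReal.toReal_mul, ENNReal.toReal_ofReal
    (Finset.prod_nonneg fun i _ => by have := hΓ i; positivity),
    ENNReal.toReal_ofReal (by positivity), ← hI] at hg2
  rw [Finset.prod_mul_distrib, Finset.prod_mul_distrib] at hg2
  simp only [Finset.prod_const, Finset.card_univ, Fintype.card_fin] at hg2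
  rw [show (m:ℝ) * (2*n+2) - ∑ i, α i = 2 * A by rw [hAdef]; ring]
  rw [show ((2:ℝ)*n+2)^m = 2^m * (n+1)^m by rw [← mul_pow]; ring]
  generalize (∫ y in {y : Fin m → Fin (2*n+1) → ℝ | Real.sqrt (∑ i, hnorm n (y i) ^ 2) < 1},
      ∏ i, hnorm n (y i) ^ (-(α i))) = I at hg2 ⊢
  generalize (∏ i, Real.Gamma ((2*n+2-α i)/2)) = P at hg2 ⊢
  have hI2 : I = ΩQ n ^ m * ((n + 1) ^ m * P) / (A * Real.Gamma A) := by
    rw [hg2]; field_simp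
  rw [hI2]
  field_simp
end

section
/- Let α₁, α₂ be real numbers with 0 < α₁ < Q and 0 < α₂ < Q, and let α = α₁+α₂. Then Ω_Q^{-2} ∫_{{(y₁,y₂) ∈ ℝ^{2n+1}×ℝ^{2n+1} : |y₁|_h² + |y₂|_h² < 1}} |y₁|_h^{-α₁} |y₂|_h^{-α₂} dy₁ dy₂ = (Q²/(2(2Q-α))) · Γ((Q-α₁)/2)Γ((Q-α₂)/2)/Γ(Q-α/2). -/
open MeasureTheory ENNReal

lemma hn_nonneg (n : ℕ) (x) : 0 ≤ hnorm n x := by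
  unfold hnorm; positivity

lemma hn_cont (n : ℕ) : Continuous (hnorm n) := by
  unfold hnorm
  refine Continuous.rpow_const ?_ (fun x => Or.inr (by norm_num))
  refine Continuous.add (Continuous.pow (continuous_finsetSum _ fun i _ => ?_) 2) (by fun_prop)
  split_ifs <;> fun_prop

lemma hn_pow4 (n : ℕ) (x) : hnorm n x ^ 4 =
    (∑ i : Fin (2*n+1), if (i : ℕ) < 2*n then (x i)^2 else 0)^2 + (x (Fin.last (2*n)))^2 := by
  unfold hnorm
  rw [← Real.rpow_natCast, ← Real.rpow_mul (by positivity)]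
  norm_num

lemma hn_dil (n : ℕ) (r : ℝ) (hr : 0 ≤ r) (x) : hnorm n (dil n r x) = r * hnorm n x := by
  have h : hnorm n (dil n r x) ^ 4 = (r * hnorm n x) ^ 4 := by
    rw [mul_pow, hn_pow4, hn_pow4]
    have : (∑ i : Fin (2*n+1), if (i : ℕ) < 2*n then (dil n r x i)^2 else 0)
        = r^2 * (∑ i : Fin (2*n+1), if (i : ℕ) < 2*n then (x i)^2 else 0) := by
      rw [Finset.mul_sum]
      refine Finset.sum_congr rfl fun i _ => ?_
      split_ifs with h
      · simp [dil, h, mul_pow]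
      · simp
    rw [this]
    simp only [dil, Fin.val_last, lt_irrefl, if_false]
    ring
  exact (pow_left_inj₀ (hn_nonneg _ _) (mul_nonneg hr (hn_nonneg _ _)) (by norm_num)).1 h

lemma vol_ball (n : ℕ) (r : ℝ) (hr : 0 < r) :
    volume {x | hnorm n x < r} = ENNReal.ofReal (r ^ (2*n+2)) * volume {x | hnorm n x < 1} := by
  let f := Matrix.toLin' (Matrix.diagonal (fun i : Fin (2*n+1) => if (i : ℕ) < 2*n then r⁻¹ else r⁻¹^2))
  have hf : ∀ x, f x = dil n r⁻¹ x := by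
    intro x; ext i
    simp only [f, Matrix.toLin'_apply, Matrix.mulVec_diagonal, dil]
    split_ifs <;> rfl
  have hd : LinearMap.det f = r⁻¹ ^ (2*n+2) := by
    simp only [f, LinearMap.det_toLin', Matrix.det_diagonal]
    rw [Fin.prod_univ_castSucc]
    simp
    ring
  have hs : {x | hnorm n x < r} = f ⁻¹' {x | hnorm n x < 1} := by
    ext x
    simp only [Set.mem_ofPred_eq, Set.mem_preimage, hf, hn_dil n r⁻¹ (by positivity)]
    rw [inv_mul_lt_iff₀ hr, mul_one]
  rw [hs, Measure.addHaar_preimage_linearMap _ (by rw [hd]; positivity), hd]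
  congr 2
  rw [inv_pow, inv_inv, abs_of_pos (by positivity)]

lemma ball_pos (n : ℕ) : 0 < volume {x | hnorm n x < 1} := by
  refine IsOpen.measure_pos _ (isOpen_lt (hn_cont n) continuous_const) ⟨0, ?_⟩
  simp [hnorm]

lemma ball_lt_top (n : ℕ) : volume {x | hnorm n x < 1} < ⊤ := by
  refine lt_of_le_of_lt (measure_mono (t := Set.Icc (fun _ => -1) (fun _ => 1)) ?_)
    isCompact_Icc.measure_lt_top
  intro x hx
  have h4 : hnorm n x ^ 4 < 1 := pow_lt_one₀ (hn_nonneg _ _) hx (by norm_num)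
  rw [hn_pow4] at h4
  have key : ∀ i, |x i| ≤ 1 := by
    intro i
    rw [← sq_le_one_iff_abs_le_one]
    by_cases h : (i : ℕ) < 2*n
    · have h1 : (x i)^2 ≤ ∑ i : Fin (2*n+1), if (i : ℕ) < 2*n then (x i)^2 else 0 := by
        have := Finset.single_le_sum (f := fun i : Fin (2*n+1) => if (i : ℕ) < 2*n then (x i)^2 else 0)
          (fun i _ => by positivity) (Finset.mem_univ i)
        simpa [h] using this
      nlinarith [sq_nonneg (x (Fin.last (2*n)))]
    · have : i = Fin.last (2*n) := by ext; simp; omega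
      subst this
      nlinarith [sq_nonneg (∑ i : Fin (2*n+1), if (i : ℕ) < 2*n then (x i)^2 else 0)]
  exact ⟨fun i => (abs_le.1 (key i)).1, fun i => (abs_le.1 (key i)).2⟩

lemma lint_rpow (b t : ℝ) (hb : 0 < b) (ht : 0 ≤ t) :
    ∫⁻ u in Set.Ioo 0 t, ENNReal.ofReal (u ^ (b - 1)) = ENNReal.ofReal (t ^ b / b) := by
  have hi : IntegrableOn (fun u : ℝ => u ^ (b - 1)) (Set.Ioc 0 t) := by
    have := intervalIntegral.intervalIntegrable_rpow' (a := 0) (b := t) (r := b - 1) (by linarith)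
    exact (intervalIntegrable_iff_integrableOn_Ioc_of_le ht).1 this
  rw [setLIntegral_congr Ioo_ae_eq_Ioc, ← ofReal_integral_eq_lintegral_ofReal hi,
    ← intervalIntegral.integral_of_le ht, integral_rpow (Or.inl (by linarith))]
  · simp [Real.zero_rpow hb.ne']
  · refine (ae_restrict_iff' measurableSet_Ioc).2 (Filter.Eventually.of_forall fun x hx => ?_)
    exact Real.rpow_nonneg hx.1.le _

/-- density of the law of the squared norm -/
noncomputable def dens (n : ℕ) (u : ℝ) : ℝ≥0∞ :=
  volume {x | hnorm n x < 1} * ENNReal.ofReal (n + 1) *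
    (Set.Ioi (0:ℝ)).indicator (fun u => ENNReal.ofReal (u ^ (((n:ℝ) + 1) - 1))) u

lemma dens_meas (n : ℕ) : Measurable (dens n) := by
  unfold dens
  refine Measurable.const_mul (Measurable.indicator (by fun_prop) measurableSet_Ioi) _

lemma law_Iio (n : ℕ) (t : ℝ) : (volume.map (fun x => hnorm n x ^ 2)) (Set.Iio t) =
    volume {x | hnorm n x < 1} * ENNReal.ofReal ((max t 0) ^ (n + 1)) := by
  have hg : Measurable (fun x => hnorm n x ^ 2) := ((hn_cont n).pow 2).measurable
  rw [Measure.map_apply hg measurableSet_Iio]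
  rcases le_or_gt t 0 with ht | ht
  · have : (fun x => hnorm n x ^ 2) ⁻¹' Set.Iio t = ∅ := by
      ext x
      simp only [Set.mem_preimage, Set.mem_Iio, Set.mem_empty_iff_false, iff_false, not_lt]
      exact ht.trans (sq_nonneg _)
    rw [this, max_eq_right ht]; simp
  · have : (fun x => hnorm n x ^ 2) ⁻¹' Set.Iio t = {x | hnorm n x < √t} := by
      ext x
      simp only [Set.mem_preimage, Set.mem_Iio, Set.mem_ofPred_eq]
      rw [Real.lt_sqrt (hn_nonneg _ _)]
    rw [this, vol_ball n _ (Real.sqrt_pos.2 ht), max_eq_left ht.le, mul_comm]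
    congr 2
    rw [show 2*n+2 = 2*(n+1) by ring, pow_mul, Real.sq_sqrt ht.le]

lemma dens_Iio (n : ℕ) (t : ℝ) : (volume.withDensity (dens n)) (Set.Iio t) =
    volume {x | hnorm n x < 1} * ENNReal.ofReal ((max t 0) ^ (n + 1)) := by
  rw [withDensity_apply _ measurableSet_Iio]
  unfold dens
  rw [lintegral_const_mul _ (Measurable.indicator (by fun_prop) measurableSet_Ioi),
    setLIntegral_indicator measurableSet_Ioi]
  have : Set.Ioi 0 ∩ Set.Iio t = Set.Ioo 0 (max t 0) := by
    ext x; simp only [Set.mem_inter_iff, Set.mem_Ioi, Set.mem_Iio, Set.mem_Ioo, lt_max_iff]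
    constructor
    · rintro ⟨h1, h2⟩; exact ⟨h1, Or.inl h2⟩
    · rintro ⟨h1, h2 | h2⟩
      · exact ⟨h1, h2⟩
      · linarith
  rw [this, lint_rpow _ _ (by positivity) (le_max_right _ _), mul_assoc,
    ← ENNReal.ofReal_mul (by positivity)]
  congr 2
  rw [mul_div_cancel₀ _ (by positivity)]
  exact_mod_cast Real.rpow_natCast (max t 0) (n+1)

lemma law_eq (n : ℕ) : volume.map (fun x => hnorm n x ^ 2) = volume.withDensity (dens n) := by
  have fin : ∀ t : ℝ, volume {x | hnorm n x < 1} * ENNReal.ofReal ((max t 0) ^ (n + 1)) ≠ ⊤ :=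
    fun t => ENNReal.mul_ne_top (ball_lt_top n).ne ENNReal.ofReal_ne_top
  refine Measure.ext_of_Ico' _ _ ?_ ?_
  · intro a b _ 
    refine ne_top_of_le_ne_top (fin b) ?_
    rw [← law_Iio]
    exact measure_mono fun x hx => hx.2
  · intro a b hab
    have : Set.Ico a b = Set.Iio b \ Set.Iio a := by
      ext x; simp [and_comm]
    rw [this, measure_sdiff (Set.Iio_subset_Iio hab.le) measurableSet_Iio.nullMeasurableSet,
      measure_sdiff (Set.Iio_subset_Iio hab.le) measurableSet_Iio.nullMeasurableSet,
      law_Iio, law_Iio, dens_Iio, dens_Iio]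
    · rw [dens_Iio]; exact fin a
    · rw [law_Iio]; exact fin a

lemma lint_beta (a b : ℝ) (ha : 0 < a) (hb : 0 < b) :
    ∫⁻ u in Set.Ioo 0 1, ENNReal.ofReal (u ^ (a - 1)) * ENNReal.ofReal ((1 - u) ^ b / b) =
      ENNReal.ofReal (Real.Gamma a * Real.Gamma b / Real.Gamma (a + b + 1)) := by
  have hB := ProbabilityTheory.beta_pos ha (show 0 < b + 1 by linarith)
  have h := ProbabilityTheory.lintegral_betaPDF_eq_one ha (show 0 < b + 1 by linarith)
  rw [ProbabilityTheory.lintegral_betaPDF] at h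
  have h2 : ∫⁻ u in Set.Ioo 0 1, ENNReal.ofReal (u ^ (a - 1)) * ENNReal.ofReal ((1 - u) ^ b / b) =
     ∫⁻ u in Set.Ioo 0 1, ENNReal.ofReal (ProbabilityTheory.beta a (b+1) / b) *
       ENNReal.ofReal (1 / ProbabilityTheory.beta a (b+1) * u ^ (a - 1) * (1 - u) ^ (b + 1 - 1)) := by
    refine setLIntegral_congr_fun measurableSet_Ioo fun u hu => ?_
    have h0 := hu.1
    rw [← ENNReal.ofReal_mul (Real.rpow_nonneg hu.1.le _), ← ENNReal.ofReal_mul (by positivity)]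
    congr 1
    rw [add_sub_cancel_right]
    field_simp
  rw [h2, lintegral_const_mul _ (by fun_prop), h, mul_one]
  congr 1
  rw [ProbabilityTheory.beta, Real.Gamma_add_one hb.ne', ← add_assoc]
  field_simp

lemma lint_main (n : ℕ) (α₁ α₂ : ℝ) (h1 : α₁ < 2*n+2) (h2 : α₂ < 2*n+2) :
    ∫⁻ p in {p : (Fin (2*n+1) → ℝ) × (Fin (2*n+1) → ℝ) |
            hnorm n p.1 ^ 2 + hnorm n p.2 ^ 2 < 1},
          ENNReal.ofReal (hnorm n p.1 ^ (-α₁) * hnorm n p.2 ^ (-α₂)) =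
    (volume {x | hnorm n x < 1} * ENNReal.ofReal (n + 1)) ^ 2 *
      ENNReal.ofReal (Real.Gamma (n + 1 - α₁ / 2) * Real.Gamma (n + 1 - α₂ / 2) /
        Real.Gamma ((n + 1 - α₁ / 2) + (n + 1 - α₂ / 2) + 1)) := by
  have hS : MeasurableSet {q : ℝ × ℝ | q.1 + q.2 < 1} :=
    measurableSet_lt (by fun_prop) (by fun_prop)
  have hg : Measurable (fun x => hnorm n x ^ 2) := ((hn_cont n).pow 2).measurable
  let F : ℝ × ℝ → ℝ≥0∞ := {q : ℝ × ℝ | q.1 + q.2 < 1}.indicator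
    (fun q => ENNReal.ofReal (q.1 ^ (-α₁/2)) * ENNReal.ofReal (q.2 ^ (-α₂/2)))
  have hF : Measurable F := Measurable.indicator (by fun_prop) hS
  have hpow : ∀ (α : ℝ) x, hnorm n x ^ (-α) = (hnorm n x ^ 2) ^ (-α/2) := by
    intro α x
    rw [← Real.rpow_natCast, ← Real.rpow_mul (hn_nonneg n x)]
    congr 1; push_cast; ring
  have hSm : MeasurableSet {p : (Fin (2*n+1) → ℝ) × (Fin (2*n+1) → ℝ) |
            hnorm n p.1 ^ 2 + hnorm n p.2 ^ 2 < 1} := (hg.prodMap hg) hS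
  set a : ℝ := n + 1 - α₁ / 2 with ha
  set b : ℝ := n + 1 - α₂ / 2 with hb
  have ha0 : 0 < a := by linarith
  have hb0 : 0 < b := by linarith
  calc _ = ∫⁻ p : (Fin (2*n+1) → ℝ) × (Fin (2*n+1) → ℝ),
        F (Prod.map (fun x => hnorm n x ^ 2) (fun x => hnorm n x ^ 2) p) := by
        rw [← lintegral_indicator hSm]
        refine lintegral_congr fun p => ?_
        by_cases hp : hnorm n p.1 ^ 2 + hnorm n p.2 ^ 2 < 1
        · rw [Set.indicator_of_mem (by exact hp)]
          simp only [F]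
          rw [Set.indicator_of_mem (by exact hp), hpow, hpow,
            ENNReal.ofReal_mul (by positivity)]
          rfl
        · rw [Set.indicator_of_notMem (by exact hp)]
          simp only [F]
          rw [Set.indicator_of_notMem (by exact hp)]
    _ = ∫⁻ q, F q ∂((volume.withDensity (dens n)).prod (volume.withDensity (dens n))) := by
        rw [← law_eq, Measure.map_prod_map _ _ hg hg, lintegral_map hF (hg.prodMap hg)]
        rfl
    _ = ∫⁻ u, ∫⁻ v, (dens n u * dens n v) * F (u, v) := by
        have hd := dens_meas n
        rw [prod_withDensity hd hd, lintegral_withDensity_eq_lintegral_mul _ (by fun_prop) hF,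
          lintegral_prod _ (by fun_prop)]
        rfl
    _ = ∫⁻ u, (Set.Ioo (0:ℝ) 1).indicator (fun u =>
          (volume {x | hnorm n x < 1} * ENNReal.ofReal (n + 1)) ^ 2 *
          (ENNReal.ofReal (u ^ (a - 1)) * ENNReal.ofReal ((1 - u) ^ b / b))) u := by
        refine lintegral_congr fun u => ?_
        by_cases hu : u ∈ Set.Ioo (0:ℝ) 1
        · rw [Set.indicator_of_mem hu, ← lint_rpow b (1 - u) hb0 (by linarith [hu.2]),
            ← mul_assoc, ← lintegral_indicator measurableSet_Ioo,
            ← lintegral_const_mul _ (Measurable.indicator (by fun_prop) measurableSet_Ioo)]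
          refine lintegral_congr fun v => ?_
          by_cases hv : v ∈ Set.Ioo (0:ℝ) (1 - u)
          · rw [Set.indicator_of_mem hv]
            simp only [F, dens]
            rw [Set.indicator_of_mem (by exact hu.1), Set.indicator_of_mem (by exact hv.1),
              Set.indicator_of_mem (by simp only [Set.mem_ofPred_eq]; linarith [hv.2])]
            have e1 : u ^ (a - 1) = u ^ ((n:ℝ) + 1 - 1) * u ^ (-α₁/2) := by
              rw [← Real.rpow_add hu.1]; congr 1; rw [ha]; ring
            have e2 : v ^ (b - 1) = v ^ ((n:ℝ) + 1 - 1) * v ^ (-α₂/2) := by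
              rw [← Real.rpow_add hv.1]; congr 1; rw [hb]; ring
            rw [e1, e2, ENNReal.ofReal_mul (Real.rpow_nonneg hu.1.le _),
              ENNReal.ofReal_mul (Real.rpow_nonneg hv.1.le _)]
            ring
          · rw [Set.indicator_of_notMem hv, mul_zero]
            by_cases hv0 : 0 < v
            · have : F (u, v) = 0 := Set.indicator_of_notMem (fun h => hv ⟨hv0, by
                simp only [Set.mem_ofPred_eq] at h; linarith⟩) _
              rw [this, mul_zero]
            · have : dens n v = 0 := by
                simp only [dens]; rw [Set.indicator_of_notMem (by exact hv0), mul_zero]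
              rw [this]; simp
        · rw [Set.indicator_of_notMem hu]
          rw [← lintegral_zero (μ := (volume : Measure ℝ))]
          refine lintegral_congr fun v => ?_
          by_cases hu0 : 0 < u
          · by_cases hv0 : 0 < v
            · have : F (u, v) = 0 := Set.indicator_of_notMem (fun h => hu ⟨hu0, by
                simp only [Set.mem_ofPred_eq] at h; linarith⟩) _
              rw [this, mul_zero]
            · have : dens n v = 0 := by
                simp only [dens]; rw [Set.indicator_of_notMem (by exact hv0), mul_zero]
              rw [this]; simp
          · have : dens n u = 0 := by
              simp only [dens]; rw [Set.indicator_of_notMem (by exact hu0), mul_zero]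
            rw [this]; simp
    _ = _ := by
        rw [lintegral_indicator measurableSet_Ioo, lintegral_const_mul _ (by fun_prop),
          lint_beta a b ha0 hb0]

/-- the two-variable case of the sharp Hardy constant. -/
theorem statement8 (n : ℕ) (hn : 1 ≤ n)
    (Q : ℝ) (hQ : Q = 2*n+2)
    (α₁ α₂ : ℝ) (hα₁ : 0 < α₁) (hα₁Q : α₁ < Q) (hα₂ : 0 < α₂) (hα₂Q : α₂ < Q)
    (α : ℝ) (hα : α = α₁ + α₂) :
    (ΩQ n ^ 2)⁻¹ *
        ∫ p in {p : (Fin (2*n+1) → ℝ) × (Fin (2*n+1) → ℝ) |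
            hnorm n p.1 ^ 2 + hnorm n p.2 ^ 2 < 1},
          hnorm n p.1 ^ (-α₁) * hnorm n p.2 ^ (-α₂)
      = (Q ^ 2 / (2 * (2 * Q - α))) *
          (Real.Gamma ((Q - α₁) / 2) * Real.Gamma ((Q - α₂) / 2) / Real.Gamma (Q - α / 2)) := by
  have hm : Measurable (hnorm n) := (hn_cont n).measurable
  have hΩ : 0 < ΩQ n := ENNReal.toReal_pos (ball_pos n).ne' (ball_lt_top n).ne
  rw [integral_eq_lintegral_of_nonneg_ae
    (Filter.Eventually.of_forall fun p => mul_nonneg (Real.rpow_nonneg (hn_nonneg _ _) _)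
      (Real.rpow_nonneg (hn_nonneg _ _) _)) (by fun_prop),
    lint_main n α₁ α₂ (by linarith) (by linarith)]
  have hG1 := Real.Gamma_pos_of_pos (show 0 < (n:ℝ) + 1 - α₁ / 2 by linarith)
  have hG2 := Real.Gamma_pos_of_pos (show 0 < (n:ℝ) + 1 - α₂ / 2 by linarith)
  have hs : (0:ℝ) < (n + 1 - α₁ / 2) + (n + 1 - α₂ / 2) := by linarith
  have hG := Real.Gamma_pos_of_pos hs
  rw [Real.Gamma_add_one hs.ne', ENNReal.toReal_mul, ENNReal.toReal_pow, ENNReal.toReal_mul,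
    ENNReal.toReal_ofReal (by positivity), ENNReal.toReal_ofReal (by positivity)]
  change (ΩQ n ^ 2)⁻¹ * ((ΩQ n * _) ^ 2 * _) = _
  rw [show (Q - α₁) / 2 = n + 1 - α₁ / 2 by rw [hQ]; ring,
    show (Q - α₂) / 2 = n + 1 - α₂ / 2 by rw [hQ]; ring,
    show Q - α / 2 = (n + 1 - α₁ / 2) + (n + 1 - α₂ / 2) by rw [hQ, hα]; ring,
    show 2 * Q - α = 2 * ((n + 1 - α₁ / 2) + (n + 1 - α₂ / 2)) by rw [hQ, hα]; ring,
    show Q = 2 * (n + 1) by rw [hQ]; ring]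
  generalize (n + 1 - α₁ / 2) + (n + 1 - α₂ / 2) = s at *
  field_simp
  try ring
end

section
/- Let m ≥ 1, let α₁,…,α_m be real numbers with 0 < α_i < Q for each i, and let α = α₁+⋯+α_m. Then ∫_{(ℝ^{2n+1})^m} (∏_{i=1}^m |y_i|_h^{-α_i}) / [max(1, |y₁|_h^Q, …, |y_m|_h^Q)]^m dy₁⋯dy_m = mQω_Q^m / (α ∏_{j=1}^m (Q-α_j)). -/
open MeasureTheory ENNReal

namespace HeisAux

/-- Tonelli for products of one-variable functions on a finite power. -/
lemma lintegral_pi_prod {E : Type*} [MeasureSpace E] [SigmaFinite (volume : Measure E)] :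
    ∀ (m : ℕ) (f : Fin m → E → ℝ≥0∞), (∀ i, Measurable (f i)) →
      ∫⁻ y : Fin m → E, ∏ i, f i (y i) = ∏ i, ∫⁻ x, f i x := by
  intro m
  induction m with
  | zero =>
    intro f hf
    simp [volume_pi, Measure.pi_of_empty]
  | succ m ih =>
    intro f hf
    have hmp := (volume_preserving_piFinSuccAbove (fun _ : Fin (m+1) => E) 0).symm
    rw [← hmp.lintegral_comp (by fun_prop)]
    simp only [Fin.prod_univ_succ]
    rw [← ih _ (fun i => hf _)]
    rw [Measure.volume_eq_prod, ← lintegral_prod_mul (hf 0).aemeasurable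
      (Finset.measurable_fun_prod _ fun i _ => (hf i.succ).comp (measurable_pi_apply i)).aemeasurable]
    rfl

lemma lintegral_Ioi_aux (c R : ℝ) (hc : 0 < c) (hR : 0 < R) :
    ∫⁻ t in Set.Ioi R, ENNReal.ofReal (c * t ^ (-c-1)) = ENNReal.ofReal (R ^ (-c)) := by
  rw [← ofReal_integral_eq_lintegral_ofReal]
  · rw [integral_const_mul, integral_Ioi_rpow_of_lt (by linarith) hR]
    congr 1
    have : -c - 1 + 1 = -c := by ring
    rw [this]
    field_simp
  · exact (integrableOn_Ioi_rpow_of_lt (by linarith) hR).const_mul c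
  · filter_upwards [ae_restrict_mem measurableSet_Ioi] with t ht
    have : 0 < t := hR.trans ht
    simp only [Pi.zero_apply]
    positivity

lemma lintegral_Ioc_aux (b t : ℝ) (hb : 0 < b) (ht : 0 < t) :
    ∫⁻ s in Set.Ioc 0 t, ENNReal.ofReal (s ^ (b-1)) = ENNReal.ofReal (t ^ b / b) := by
  rw [← ofReal_integral_eq_lintegral_ofReal]
  · rw [← intervalIntegral.integral_of_le ht.le, integral_rpow (Or.inl (by linarith))]
    congr 1
    have : b - 1 + 1 = b := by ring
    rw [this, Real.zero_rpow hb.ne', sub_zero]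
  · exact (intervalIntegrable_iff_integrableOn_Ioc_of_le ht.le).1
      (intervalIntegral.intervalIntegrable_rpow' (by linarith))
  · filter_upwards [ae_restrict_mem measurableSet_Ioc] with s hs
    have : 0 < s := hs.1
    simp only [Pi.zero_apply]
    positivity

lemma base_nonneg (n : ℕ) (x : Fin (2*n+1) → ℝ) :
    0 ≤ (∑ i : Fin (2*n+1), if (i : ℕ) < 2*n then (x i)^2 else 0)^2
    + (x (Fin.last (2*n)))^2 := by positivity

lemma hnorm_nonneg (n : ℕ) (x : Fin (2*n+1) → ℝ) : 0 ≤ hnorm n x :=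
  Real.rpow_nonneg (base_nonneg n x) _

lemma hnorm_pow4 (n : ℕ) (x : Fin (2*n+1) → ℝ) :
    hnorm n x ^ 4 = (∑ i : Fin (2*n+1), if (i : ℕ) < 2*n then (x i)^2 else 0)^2
    + (x (Fin.last (2*n)))^2 := by
  unfold hnorm
  rw [← Real.rpow_natCast, ← Real.rpow_mul (base_nonneg n x)]
  norm_num

lemma measurable_hnorm (n : ℕ) : Measurable (hnorm n) := by
  unfold hnorm
  have h : ∀ i : Fin (2*n+1), Measurable
      (fun x : Fin (2*n+1) → ℝ => if (i : ℕ) < 2*n then (x i)^2 else 0) := by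
    intro i
    split_ifs <;> fun_prop
  fun_prop

lemma coord_sq_le (n : ℕ) (x : Fin (2*n+1) → ℝ) (i : Fin (2*n+1)) (hi : (i:ℕ) < 2*n) :
    x i ^ 4 ≤ hnorm n x ^ 4 := by
  rw [hnorm_pow4]
  have h0 : ∀ j ∈ Finset.univ, 0 ≤ (if ((j : Fin (2*n+1)) : ℕ) < 2*n then (x j)^2 else 0) := by
    intro j _
    split_ifs <;> positivity
  have h1 := Finset.single_le_sum h0 (Finset.mem_univ i)
  simp only [hi, if_true] at h1
  have h2 : (x i ^ 2)^2 ≤ (∑ i : Fin (2*n+1), if (i : ℕ) < 2*n then (x i)^2 else 0)^2 :=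
    pow_le_pow_left₀ (by positivity) h1 2
  nlinarith [sq_nonneg (x (Fin.last (2*n)))]

lemma last_sq_le (n : ℕ) (x : Fin (2*n+1) → ℝ) :
    x (Fin.last (2*n)) ^ 2 ≤ hnorm n x ^ 4 := by
  rw [hnorm_pow4]
  nlinarith [sq_nonneg (∑ i : Fin (2*n+1), if (i : ℕ) < 2*n then (x i)^2 else 0)]

lemma eq_last (n : ℕ) (i : Fin (2*n+1)) (hi : ¬ (i:ℕ) < 2*n) : i = Fin.last (2*n) := by
  ext
  simp
  omega

lemma hnorm_pos (n : ℕ) (x : Fin (2*n+1) → ℝ) (hx : x ≠ 0) : 0 < hnorm n x := by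
  refine (hnorm_nonneg n x).lt_of_ne' fun h => hx ?_
  ext i
  by_cases hi : (i:ℕ) < 2*n
  · have := coord_sq_le n x i hi
    rw [h] at this
    have h4 : x i ^ 4 = 0 := le_antisymm (by simpa using this) (by positivity)
    simpa using h4
  · rw [eq_last n i hi]
    have := last_sq_le n x
    rw [h] at this
    have h4 : x (Fin.last (2*n)) ^ 2 = 0 := le_antisymm (by simpa using this) (by positivity)
    simpa using h4

lemma ball_finite (n : ℕ) : volume {x : Fin (2*n+1) → ℝ | hnorm n x < 1} ≠ ∞ := by
  have hsub : {x : Fin (2*n+1) → ℝ | hnorm n x < 1} ⊆ Set.Icc (fun _ => -1) (fun _ => 1) := by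
    intro x hx
    have hx : hnorm n x < 1 := hx
    have h4 : hnorm n x ^ 4 ≤ 1 := pow_le_one₀ (hnorm_nonneg n x) hx.le
    have key : ∀ i, |x i| ≤ 1 := by
      intro i
      by_cases hi : (i:ℕ) < 2*n
      · have := (coord_sq_le n x i hi).trans h4
        rw [← sq_le_one_iff_abs_le_one]
        nlinarith [sq_nonneg (x i)]
      · rw [eq_last n i hi, ← sq_le_one_iff_abs_le_one]
        exact (last_sq_le n x).trans h4
    exact ⟨fun i => (abs_le.1 (key i)).1, fun i => (abs_le.1 (key i)).2⟩
  exact ((measure_mono hsub).trans_lt (isCompact_Icc.measure_lt_top)).ne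

lemma hnorm_dil (n : ℕ) (r : ℝ) (hr : 0 < r) (x : Fin (2*n+1) → ℝ) :
    hnorm n (dil n r x) = r * hnorm n x := by
  have h : hnorm n (dil n r x) ^ 4 = (r * hnorm n x) ^ 4 := by
    rw [mul_pow, hnorm_pow4, hnorm_pow4]
    have : (∑ i : Fin (2*n+1), if (i : ℕ) < 2*n then (dil n r x i)^2 else 0)
        = r^2 * ∑ i : Fin (2*n+1), if (i : ℕ) < 2*n then (x i)^2 else 0 := by
      rw [Finset.mul_sum]
      refine Finset.sum_congr rfl fun i _ => ?_
      by_cases hi : (i:ℕ) < 2*n <;> simp [hi, dil, mul_pow]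
    rw [this]
    simp [dil]
    ring
  exact (pow_left_inj₀ (hnorm_nonneg _ _) (mul_nonneg hr.le (hnorm_nonneg _ _)) (by norm_num)).1 h

lemma vol_ball (n : ℕ) (r : ℝ) (hr : 0 < r) :
    volume {x : Fin (2*n+1) → ℝ | hnorm n x < r} = ENNReal.ofReal (ΩQ n * r ^ ((2:ℝ)*n+2)) := by
  classical
  let D : Fin (2*n+1) → ℝ := fun i => if (i:ℕ) < 2*n then r else r^2
  have hdet : (Matrix.diagonal D).det = r ^ (2*n+2) := by
    rw [Matrix.det_diagonal, Fin.prod_univ_castSucc]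
    simp [D]
    ring
  have hne : (Matrix.diagonal D).det ≠ 0 := by rw [hdet]; positivity
  have hm := Real.smul_map_diagonal_volume_pi hne
  have hdil : ⇑(Matrix.toLin' (Matrix.diagonal D)) = dil n r := by
    ext x i
    simp only [Matrix.toLin'_apply, Matrix.mulVec_diagonal, D, dil]
    split_ifs <;> rfl
  have hmeas : MeasurableSet {x : Fin (2*n+1) → ℝ | hnorm n x < r} :=
    measurableSet_lt (measurable_hnorm n) measurable_const
  conv_lhs => rw [← hm]
  rw [Measure.smul_apply, Measure.map_apply
    (Continuous.measurable (LinearMap.continuous_on_pi _)) hmeas, hdil, hdet]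
  have hpre : dil n r ⁻¹' {x | hnorm n x < r} = {x | hnorm n x < 1} := by
    ext x
    simp only [Set.mem_preimage, Set.mem_setOf_eq, hnorm_dil n r hr]
    constructor
    · intro h
      by_contra! h'
      nlinarith
    · intro h
      nlinarith
  rw [hpre, abs_of_pos (by positivity), smul_eq_mul, mul_comm,
    ENNReal.ofReal_mul (by unfold ΩQ; positivity), ΩQ, ENNReal.ofReal_toReal (ball_finite n)]
  congr 2
  rw [← Real.rpow_natCast]
  push_cast
  rfl

/-- Radial integral over a Koranyi ball. -/
lemma radial (n : ℕ) (Q : ℝ) (hQ : Q = 2*n+2) (a t : ℝ) (ha : 0 < a) (haQ : a < Q) (ht : 0 < t) :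
    ∫⁻ x, (if hnorm n x < t then ENNReal.ofReal (hnorm n x ^ (-a)) else 0)
      = ENNReal.ofReal (Q * ΩQ n * t ^ (Q - a) / (Q - a)) := by
  have hN := measurable_hnorm n
  have hΩ : 0 ≤ ΩQ n := by unfold ΩQ; positivity
  have hQ0 : 0 < Q := ha.trans haQ
  have h1 : ∀ᵐ x : Fin (2*n+1) → ℝ,
      (if hnorm n x < t then ENNReal.ofReal (hnorm n x ^ (-a)) else 0)
      = ∫⁻ s in Set.Ioi (0:ℝ), (if hnorm n x < min s t then
          ENNReal.ofReal (a * s ^ (-a-1)) else 0) := by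
    have hne : ∀ᵐ x : Fin (2*n+1) → ℝ, x ≠ 0 := by
      simp [ae_iff]
    filter_upwards [hne] with x hx
    have hp := hnorm_pos n x hx
    by_cases hxt : hnorm n x < t
    · simp only [hxt, if_true, lt_min_iff, and_true]
      rw [← lintegral_Ioi_aux a _ ha hp, ← lintegral_indicator measurableSet_Ioi,
        ← lintegral_indicator measurableSet_Ioi]
      congr 1
      ext s
      by_cases hs : hnorm n x < s
      · simp [Set.indicator, hs, hp.trans hs]
      · simp [Set.indicator, hs]
    · simp [hxt, lt_min_iff]
  rw [lintegral_congr_ae h1, lintegral_lintegral_swap]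
  swap
  · apply Measurable.aemeasurable
    refine Measurable.ite ?_ (by fun_prop) measurable_const
    exact measurableSet_lt (by fun_prop) (by fun_prop)
  have h2 : ∀ s ∈ Set.Ioi (0:ℝ), (∫⁻ x : Fin (2*n+1) → ℝ, (if hnorm n x < min s t then
          ENNReal.ofReal (a * s ^ (-a-1)) else 0))
      = ENNReal.ofReal (a * s ^ (-a-1)) * ENNReal.ofReal (ΩQ n * (min s t) ^ Q) := by
    intro s hs
    have hs : 0 < s := hs
    rw [hQ, ← vol_ball n _ (lt_min hs ht), ← setLIntegral_const, ← lintegral_indicator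
      (measurableSet_lt (measurable_hnorm n) measurable_const)]
    rfl
  rw [setLIntegral_congr_fun measurableSet_Ioi h2, ← Set.Ioc_union_Ioi_eq_Ioi ht.le,
    lintegral_union measurableSet_Ioi (Set.Ioc_disjoint_Ioi le_rfl)]
  have h3 : ∫⁻ s in Set.Ioc 0 t, ENNReal.ofReal (a * s ^ (-a-1)) *
      ENNReal.ofReal (ΩQ n * (min s t) ^ Q) = ENNReal.ofReal (a * ΩQ n) *
        ENNReal.ofReal (t ^ (Q - a) / (Q - a)) := by
    rw [← lintegral_Ioc_aux _ _ (sub_pos.2 haQ) ht, ← lintegral_const_mul _ (by fun_prop)]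
    refine setLIntegral_congr_fun measurableSet_Ioc fun s hs => ?_
    have hs0 : 0 < s := hs.1
    rw [min_eq_left hs.2, ← ENNReal.ofReal_mul (by positivity), ← ENNReal.ofReal_mul (by positivity)]
    congr 1
    have : s ^ (Q - a - 1) = s ^ (-a-1) * s ^ Q := by
      rw [← Real.rpow_add hs0]; congr 1; ring
    rw [this]; ring
  have h4 : ∫⁻ s in Set.Ioi t, ENNReal.ofReal (a * s ^ (-a-1)) *
      ENNReal.ofReal (ΩQ n * (min s t) ^ Q) = ENNReal.ofReal (t ^ (-a)) *
        ENNReal.ofReal (ΩQ n * t ^ Q) := by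
    rw [← lintegral_Ioi_aux _ _ ha ht, ← lintegral_mul_const _ (by fun_prop)]
    refine setLIntegral_congr_fun measurableSet_Ioi fun s hs => ?_
    rw [min_eq_right (le_of_lt hs)]
  have hQa : 0 < Q - a := sub_pos.2 haQ
  rw [h3, h4, ← ENNReal.ofReal_mul (by positivity), ← ENNReal.ofReal_mul (by positivity),
    ← ENNReal.ofReal_add (by positivity) (by positivity)]
  congr 1
  have : t ^ (Q - a) = t ^ (-a) * t ^ Q := by
      rw [← Real.rpow_add ht]; congr 1; ring
  rw [this]
  field_simp
  ring

/-- Layer-cake representation of the integrand. -/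
lemma pointwise (m : ℕ) (hm : 1 ≤ m) (Q : ℝ) (hQ : 0 < Q) (α : Fin m → ℝ) (N : Fin m → ℝ)
    (hN : ∀ i, 0 ≤ N i) :
    ENNReal.ofReal ((∏ i, N i ^ (-(α i))) / (max 1 (⨆ i, N i ^ Q)) ^ m)
      = ∫⁻ t in Set.Ioi (1:ℝ), ENNReal.ofReal (m * Q * t ^ (-(m * Q) - 1)) *
          ∏ i, (if N i < t then ENNReal.ofReal (N i ^ (-(α i))) else 0) := by
  have : Nonempty (Fin m) := ⟨⟨0, hm⟩⟩
  have hm0 : (0:ℝ) < m := by exact_mod_cast hm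
  set S := max 1 (⨆ i, N i ^ Q) with hS
  have hS1 : 1 ≤ S := le_max_left _ _
  have hS0 : 0 < S := by linarith
  have hR0 : 0 < S ^ (1/Q) := by positivity
  have hiff : ∀ t, S ^ (1/Q) < t ↔ 1 < t ∧ ∀ i, N i < t := by
    intro t
    by_cases ht : 0 < t
    · have e : S ^ (1/Q) < t ↔ S < t ^ Q := by
        rw [one_div]
        exact Real.rpow_inv_lt_iff_of_pos hS0.le ht.le hQ
      rw [e, hS, max_lt_iff, Real.one_lt_rpow_iff_of_pos ht]
      constructor
      · rintro ⟨h1, h2⟩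
        refine ⟨by rcases h1 with h | h; exact h.1; linarith [h.2], fun i => ?_⟩
        have := (le_ciSup (Set.finite_range fun i => N i ^ Q).bddAbove i).trans_lt h2
        exact (Real.rpow_lt_rpow_iff (hN i) ht.le hQ).1 this
      · rintro ⟨h1, h2⟩
        refine ⟨Or.inl ⟨h1, hQ⟩, ?_⟩
        obtain ⟨i, hi⟩ := exists_eq_ciSup_of_finite (f := fun i => N i ^ Q)
        rw [← hi]
        exact Real.rpow_lt_rpow (hN i) (h2 i) hQ
    · constructor
      · intro h; linarith
      · rintro ⟨h, _⟩; linarith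
  have hprod : 0 ≤ ∏ i, N i ^ (-(α i)) := Finset.prod_nonneg fun i _ => Real.rpow_nonneg (hN i) _
  have hpow : (S ^ (1/Q)) ^ (-(m * Q)) = (S ^ m)⁻¹ := by
    rw [← Real.rpow_mul hS0.le, ← Real.rpow_natCast, ← Real.rpow_neg hS0.le]
    congr 1
    field_simp
  rw [div_eq_mul_inv, ENNReal.ofReal_mul hprod, ← hpow,
    ← lintegral_Ioi_aux _ _ (by positivity) hR0, mul_comm,
    ← lintegral_mul_const _ (by fun_prop), ← lintegral_indicator measurableSet_Ioi,
    ← lintegral_indicator measurableSet_Ioi]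
  congr 1
  ext t
  by_cases h : S ^ (1/Q) < t
  · have h' := (hiff t).1 h
    rw [Set.indicator_of_mem (Set.mem_Ioi.2 h), Set.indicator_of_mem (Set.mem_Ioi.2 h'.1)]
    simp only [h'.2, if_true]
    rw [ENNReal.ofReal_prod_of_nonneg fun i _ => Real.rpow_nonneg (hN i) _]
  · rw [Set.indicator_of_notMem (by simpa using h)]
    by_cases h1 : 1 < t
    · rw [Set.indicator_of_mem (Set.mem_Ioi.2 h1)]
      have : ∃ i, ¬ N i < t := by
        by_contra! hc
        exact h ((hiff t).2 ⟨h1, hc⟩)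
      obtain ⟨i, hi⟩ := this
      rw [Finset.prod_eq_zero (Finset.mem_univ i) (by simp [hi]), mul_zero]
    · rw [Set.indicator_of_notMem (by simpa using h1)]

end HeisAux

open HeisAux in
/-- the explicit value of the sharp Hardy–Littlewood–Pólya constant
`ℬ_m^h = mQω_Q^m / (α ∏ (Q - α_j))`. -/
theorem statement12 (n : ℕ) (hn : 1 ≤ n) (m : ℕ) (hm : 1 ≤ m)
    (Q : ℝ) (hQ : Q = 2*n+2) (ω : ℝ) (hω : ω = Q * ΩQ n)
    (α : Fin m → ℝ) (hα : ∀ i, 0 < α i ∧ α i < Q) :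
    (∫ y : Fin m → Fin (2*n+1) → ℝ,
        (∏ i, hnorm n (y i) ^ (-(α i))) / (max 1 (⨆ i, hnorm n (y i) ^ Q)) ^ m)
      = m * Q * ω ^ m / ((∑ i, α i) * ∏ j, (Q - α j)) := by
  have hN := measurable_hnorm n
  have hQ0 : 0 < Q := by rw [hQ]; positivity
  have hm0 : (0:ℝ) < m := by exact_mod_cast hm
  have : Nonempty (Fin m) := ⟨⟨0, hm⟩⟩
  have hω0 : 0 ≤ ω := by rw [hω]; unfold ΩQ; positivity
  have hA : 0 < ∑ i, α i := Finset.sum_pos (fun i _ => (hα i).1) Finset.univ_nonempty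
  have hP : 0 < ∏ j, (Q - α j) := Finset.prod_pos fun i _ => sub_pos.2 (hα i).2
  have hmeas : Measurable fun y : Fin m → Fin (2*n+1) → ℝ =>
      (∏ i, hnorm n (y i) ^ (-(α i))) / (max 1 (⨆ i, hnorm n (y i) ^ Q)) ^ m := by
    have : Measurable fun y : Fin m → Fin (2*n+1) → ℝ => ⨆ i, hnorm n (y i) ^ Q :=
      Measurable.iSup fun i => by fun_prop
    fun_prop
  rw [integral_eq_lintegral_of_nonneg_ae _ hmeas.aestronglyMeasurable]
  swap
  · refine Filter.Eventually.of_forall fun y => ?_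
    have : 0 ≤ ∏ i, hnorm n (y i) ^ (-(α i)) :=
      Finset.prod_nonneg fun i _ => Real.rpow_nonneg (hnorm_nonneg n _) _
    simp only [Pi.zero_apply]
    positivity
  simp_rw [fun y : Fin m → Fin (2*n+1) → ℝ =>
    pointwise m hm Q hQ0 α (fun i => hnorm n (y i)) (fun i => hnorm_nonneg n _)]
  have hm1 : ∀ i, Measurable (fun p : ℝ × (Fin (2*n+1) → ℝ) =>
      if hnorm n p.2 < p.1 then ENNReal.ofReal (hnorm n p.2 ^ (-(α i))) else 0) := by
    intro i
    refine Measurable.ite ?_ (by fun_prop) measurable_const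
    exact measurableSet_lt (by fun_prop) (by fun_prop)
  rw [lintegral_lintegral_swap]
  swap
  · apply Measurable.aemeasurable
    refine Measurable.mul (by fun_prop) ?_
    refine Finset.measurable_fun_prod _ fun i _ => ?_
    exact (hm1 i).comp (f := fun z : (Fin m → Fin (2*n+1) → ℝ) × ℝ => (z.2, z.1 i)) (by fun_prop)
  have h2 : ∀ t ∈ Set.Ioi (1:ℝ), (∫⁻ y : Fin m → Fin (2*n+1) → ℝ,
      ENNReal.ofReal (m * Q * t ^ (-(m * Q) - 1)) *
          ∏ i, (if hnorm n (y i) < t then ENNReal.ofReal (hnorm n (y i) ^ (-(α i))) else 0))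
      = ENNReal.ofReal (m * Q * ω ^ m / ((∑ i, α i) * ∏ j, (Q - α j))) *
        ENNReal.ofReal ((∑ i, α i) * t ^ (-(∑ i, α i) - 1)) := by
    intro t ht
    have ht0 : 0 < t := lt_trans one_pos ht
    have hmi : ∀ i, Measurable (fun x : Fin (2*n+1) → ℝ =>
        if hnorm n x < t then ENNReal.ofReal (hnorm n x ^ (-(α i))) else 0) := fun i =>
      (hm1 i).comp (f := fun x => (t, x)) (by fun_prop)
    have hmp : Measurable fun y : Fin m → Fin (2*n+1) → ℝ =>
        ∏ i, (if hnorm n (y i) < t then ENNReal.ofReal (hnorm n (y i) ^ (-(α i))) else 0) :=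
      Finset.measurable_fun_prod _ fun i _ => (hmi i).comp (measurable_pi_apply i)
    rw [lintegral_const_mul _ hmp, lintegral_pi_prod m
      (fun i x => if hnorm n x < t then ENNReal.ofReal (hnorm n x ^ (-(α i))) else 0) hmi]
    simp_rw [fun i => radial n Q hQ (α i) t (hα i).1 (hα i).2 ht0]
    rw [← hω, ← ENNReal.ofReal_prod_of_nonneg, ← ENNReal.ofReal_mul (by positivity),
      ← ENNReal.ofReal_mul (by positivity)]
    · congr 1
      rw [Finset.prod_div_distrib, Finset.prod_mul_distrib, ← Real.rpow_sum_of_pos ht0]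
      simp only [Finset.prod_const, Finset.card_univ, Fintype.card_fin, Finset.sum_sub_distrib,
        Finset.sum_const, nsmul_eq_mul]
      have : t ^ (-(∑ i, α i) - 1) = t ^ (-(m * Q) - 1) * t ^ (m * Q - ∑ i, α i) := by
        rw [← Real.rpow_add ht0]; congr 1; ring
      rw [this]
      field_simp
    · intro i _
      have := sub_pos.2 (hα i).2
      positivity
  rw [setLIntegral_congr_fun measurableSet_Ioi h2, lintegral_const_mul _ (by fun_prop),
    lintegral_Ioi_aux _ _ hA one_pos]
  simp only [Real.one_rpow, ENNReal.ofReal_one, mul_one]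
  exact ENNReal.toReal_ofReal (by positivity)
end
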